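/- Let p be an odd prime and H ≤ GL_2(\bar{F}_p) be a finite subgroup whose order is prime to p, acting irreducibly on \bar{F}_p^2, and such that the image of H in PGL_2(\bar{F}_p) contains a cyclic subgroup of even order greater than 5. Then H contains the scalar matrix -1. -/

import Mathlib

/-!
STATEMENT 2.  Let `p` be an odd prime and `H ≤ GL₂(\bar F_p)` a finite subgroup of order
prime to `p`, acting irreducibly on `\bar F_p²`, such that the image of `H` in
`PGL₂(\bar F_p)` (the quotient of `GL₂` by its center) contains a cyclic subgroup of even
order greater than `5` (i.e. contains the image of an element of `H` of even order `> 5`).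
Then `H` contains the scalar matrix `-1`.
-/

open Matrix

/-- If commuting is transitive on nontrivial elements and every element commuting with a conjugate
of itself commutes with the conjugating element, then a finite group is commutative. -/
theorem commute_of_commute_conj_of_commute_trans (n : ℕ) :
    ∀ {G : Type*} [Group G] [Finite G], Nat.card G = n →
      (∀ x y z : G, x ≠ 1 → Commute x y → Commute x z → Commute y z) →
      (∀ x y : G, Commute x (y * x * y⁻¹) → Commute x y) → ∀ x y : G, Commute x y := by
  induction n using Nat.strong_induction_on with
  | _ n ih =>
  intro G _ _ hn h1 h2
  rcases subsingleton_or_nontrivial G with hG | hG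
  · intro x y
    exact Subsingleton.elim _ _
  obtain ⟨q, hq, hqn⟩ := Nat.exists_prime_and_dvd (Finite.one_lt_card (α := G)).ne'
  have : Fact q.Prime := ⟨hq⟩
  let P : Sylow q G := default
  have hP : Nontrivial P := (Subgroup.nontrivial_iff_ne_bot _).2 (P.ne_bot_of_dvd_card hqn)
  have hPcomm : ∀ a ∈ P, ∀ b ∈ P, Commute a b := by
    have := P.2.center_nontrivial
    obtain ⟨⟨z, hz⟩, hz1⟩ := exists_ne (1 : Subgroup.center P)
    have hc : ∀ a (ha : a ∈ P), Commute (z : G) a := fun a ha =>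
      (congrArg Subtype.val (Subgroup.mem_center_iff.1 hz ⟨a, ha⟩)).symm
    intro a ha b hb
    refine h1 z a b (fun h => hz1 ?_) (hc a ha) (hc b hb)
    ext
    exact h
  have hN : Subgroup.normalizer (P : Subgroup G) ≤ Subgroup.centralizer (P : Set G) := by
    intro y hy x hx
    exact h2 x y (hPcomm x hx _ ((Subgroup.mem_normalizer_iff.1 hy x).1 hx))
  have hcompl := MonoidHom.ker_transferSylow_isComplement' P hN
  set N := (MonoidHom.transferSylow P hN).ker
  by_cases hbot : N = ⊥
  · rw [hbot, Subgroup.isComplement'_bot_left] at hcompl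
    have hmem : ∀ x : G, x ∈ P := fun x => by
      have : x ∈ (P : Subgroup G) := hcompl ▸ Subgroup.mem_top x
      exact this
    exact fun x y => hPcomm x (hmem x) y (hmem y)
  have hlt : Nat.card N < n := by
    have hmul := hcompl.card_mul_card
    have h1P : 1 < Nat.card P := Finite.one_lt_card
    have h0 : 0 < Nat.card N := Nat.card_pos
    rw [← hn, ← hmul]
    exact lt_mul_of_one_lt_right h0 h1P
  have hNcomm : ∀ x y : N, Commute x y := by
    refine ih _ hlt rfl (fun x y z hx hxy hxz => ?_) (fun x y hxy => ?_)
    · exact Subtype.ext (h1 x y z (fun h => hx (Subtype.ext h))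
        (congrArg Subtype.val hxy) (congrArg Subtype.val hxz))
    · exact Subtype.ext (h2 x y (congrArg Subtype.val hxy))
  obtain ⟨x, hxN, hx1⟩ := N.bot_or_exists_ne_one.resolve_left hbot
  have hx : ∀ y, Commute x y := fun y => h2 x y <| congrArg Subtype.val <|
    hNcomm ⟨x, hxN⟩ ⟨y * x * y⁻¹, (inferInstance : N.Normal).conj_mem x hxN y⟩
  exact fun y z => h1 x y z hx1 (hx y) (hx z)

namespace Matrix

variable {F : Type*} [Field F]

theorem mem_range_scalar_fin_two {M : Matrix (Fin 2) (Fin 2) F} :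
    M ∈ Set.range (scalar (Fin 2)) ↔ M 0 1 = 0 ∧ M 1 0 = 0 ∧ M 0 0 = M 1 1 := by
  constructor
  · rintro ⟨a, rfl⟩
    simp
  · rintro ⟨h1, h2, h3⟩
    refine ⟨M 0 0, ?_⟩
    ext i j
    fin_cases i <;> fin_cases j <;> simp [h1, h2, h3]

/-- A matrix commuting with a non-scalar `2 × 2` matrix `X` is a linear polynomial in `X`. -/
theorem exists_eq_smul_add_smul_of_commute {X Y : Matrix (Fin 2) (Fin 2) F}
    (hX : X ∉ Set.range (scalar (Fin 2))) (h : Commute X Y) :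
    ∃ a b : F, Y = a • 1 + b • X := by
  have e (i j) : (X * Y) i j = (Y * X) i j := by rw [h.eq]
  have e00 := e 0 0
  have e01 := e 0 1
  have e10 := e 1 0
  simp only [mul_apply, Fin.sum_univ_two] at e00 e01 e10
  have key (b : F) (h01 : Y 0 1 = b * X 0 1) (h10 : Y 1 0 = b * X 1 0)
      (hd : Y 0 0 - Y 1 1 = b * (X 0 0 - X 1 1)) : ∃ a b : F, Y = a • 1 + b • X := by
    refine ⟨Y 0 0 - b * X 0 0, b, ?_⟩
    ext i j
    fin_cases i <;> fin_cases j <;> simp [h01, h10]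
    linear_combination -hd
  rw [mem_range_scalar_fin_two] at hX
  by_cases h1 : X 0 1 = 0
  · by_cases h2 : X 1 0 = 0
    · have h3 : X 0 0 - X 1 1 ≠ 0 := fun h3 => hX ⟨h1, h2, sub_eq_zero.1 h3⟩
      refine key ((Y 0 0 - Y 1 1) / (X 0 0 - X 1 1)) ?_ ?_ ?_
      · apply mul_left_cancel₀ h3
        field_simp
        linear_combination e01
      · apply mul_left_cancel₀ h3
        field_simp
        linear_combination -e10
      · field_simp
    · refine key (Y 1 0 / X 1 0) ?_ ?_ ?_
      · field_simp
        linear_combination -e00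
      · field_simp
      · field_simp
        linear_combination e10
  · refine key (Y 0 1 / X 0 1) ?_ ?_ ?_
    · field_simp
    · field_simp
      linear_combination e00
    · field_simp
      linear_combination -e01

theorem commute_of_commute_of_notMem_range_scalar {X Y Z : Matrix (Fin 2) (Fin 2) F}
    (hX : X ∉ Set.range (scalar (Fin 2))) (hY : Commute X Y) (hZ : Commute X Z) :
    Commute Y Z := by
  obtain ⟨a, b, rfl⟩ := exists_eq_smul_add_smul_of_commute hX hY
  exact ((Commute.one_left Z).smul_left a).add_left (hZ.smul_left b)

theorem eq_or_eq_adjugate_of_commute {X Y : Matrix (Fin 2) (Fin 2) F}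
    (h2 : (2 : F) ≠ 0) (hX : X ∉ Set.range (scalar (Fin 2))) (h : Commute X Y)
    (htr : Y.trace = X.trace) (hdet : Y.det = X.det) (hdisc : X.trace ^ 2 - 4 * X.det ≠ 0) :
    Y = X ∨ Y = X.adjugate := by
  obtain ⟨a, b, rfl⟩ := exists_eq_smul_add_smul_of_commute hX h
  simp only [trace_fin_two, det_fin_two, add_apply, smul_apply, one_apply, smul_eq_mul] at *
  simp only [Fin.isValue, if_true, one_ne_zero, zero_ne_one, if_false, mul_one, mul_zero,
    zero_add] at *
  have hb : (b - 1) * (b + 1) = 0 := by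
    apply mul_right_cancel₀ hdisc
    linear_combination (2 * a + (b + 1) * (X 0 0 + X 1 1)) * htr - 4 * hdet
  rcases mul_eq_zero.1 hb with hb | hb
  · left
    obtain rfl : b = 1 := sub_eq_zero.1 hb
    have ha : a = 0 := by
      apply mul_left_cancel₀ h2
      linear_combination htr
    simp [ha]
  · right
    obtain rfl : b = -1 := eq_neg_of_add_eq_zero_left hb
    have ha : a = X 0 0 + X 1 1 := by
      apply mul_left_cancel₀ h2
      linear_combination htr
    rw [adjugate_fin_two]
    ext i j
    fin_cases i <;> fin_cases j <;> simp [ha]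

theorem mem_range_scalar_of_eq_adjugate {X : Matrix (Fin 2) (Fin 2) F}
    (h2 : (2 : F) ≠ 0) (h : X = X.adjugate) : X ∈ Set.range (scalar (Fin 2)) := by
  rw [adjugate_fin_two] at h
  have e (i j) := congrFun (congrFun h i) j
  have e00 := e 0 0
  have e01 := e 0 1
  have e10 := e 1 0
  simp only [of_apply, cons_val', cons_val_zero, cons_val_one, cons_val_fin_one, Fin.isValue]
    at e00 e01 e10
  rw [mem_range_scalar_fin_two]
  refine ⟨?_, ?_, e00⟩
  · apply mul_left_cancel₀ h2
    linear_combination e01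
  · apply mul_left_cancel₀ h2
    linear_combination e10

/-- In characteristic `p`, the `p`-th power of a `2 × 2` matrix with zero discriminant is
scalar. -/
theorem pow_char_mem_range_scalar {p : ℕ} [Fact p.Prime] [CharP F p] (h2 : (2 : F) ≠ 0)
    {X : Matrix (Fin 2) (Fin 2) F} (hdisc : X.trace ^ 2 - 4 * X.det = 0) :
    X ^ p ∈ Set.range (scalar (Fin 2)) := by
  set c : F := X.trace / 2 with hc
  have hsq : (X - scalar (Fin 2) c) ^ 2 = 0 := by
    simp only [trace_fin_two, det_fin_two] at hdisc hc
    rw [pow_two]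
    ext i j
    fin_cases i <;> fin_cases j <;> simp [mul_apply, Fin.sum_univ_two, hc] <;> field_simp
    · linear_combination hdisc
    · ring
    · ring
    · linear_combination hdisc
  have hpow : (X - scalar (Fin 2) c) ^ p = 0 :=
    pow_eq_zero_of_le (Fact.out : p.Prime).two_le hsq
  rw [sub_pow_char_of_commute _ (scalar_commute c (Commute.all _) X).symm, sub_eq_zero] at hpow
  exact ⟨c ^ p, by rw [hpow, map_pow]⟩

namespace GeneralLinearGroup

theorem notMem_range_scalar_iff {x : GL (Fin 2) F} :
    (x : Matrix (Fin 2) (Fin 2) F) ∉ Set.range (Matrix.scalar (Fin 2)) ↔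
      x ∉ Subgroup.center (GL (Fin 2) F) :=
  mem_center_iff_val_mem_range_scalar.not.symm

theorem commute_of_commute_of_notMem_center {x y z : GL (Fin 2) F}
    (hx : x ∉ Subgroup.center (GL (Fin 2) F)) (hy : Commute x y) (hz : Commute x z) :
    Commute y z :=
  Units.ext <| commute_of_commute_of_notMem_range_scalar (notMem_range_scalar_iff.2 hx)
    (congrArg Units.val hy) (congrArg Units.val hz)

/-- If a non-scalar element of `GL₂` of order prime to the characteristic commutes with a
conjugate of itself, then this conjugate is the element itself or its adjugate. -/
theorem conj_eq_or_eq_adjugate {p : ℕ} [Fact p.Prime] [CharP F p] (h2 : (2 : F) ≠ 0)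
    {x y : GL (Fin 2) F} (hx : x ∉ Subgroup.center (GL (Fin 2) F))
    (hp : p.Coprime (orderOf x)) (h : Commute x (y * x * y⁻¹)) :
    y * x * y⁻¹ = x ∨ (↑(y * x * y⁻¹) : Matrix (Fin 2) (Fin 2) F) =
      (x : Matrix (Fin 2) (Fin 2) F).adjugate := by
  rw [Units.ext_iff]
  refine eq_or_eq_adjugate_of_commute h2 (notMem_range_scalar_iff.2 hx)
    (congrArg Units.val h) ?_ ?_ ?_
  · rw [Units.val_mul, Units.val_mul, trace_units_conj]
  · rw [Units.val_mul, Units.val_mul, det_units_conj]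
  · intro hdisc
    obtain ⟨m, hm⟩ := exists_pow_eq_self_of_coprime hp
    refine hx (hm ▸ Subgroup.pow_mem _ (mem_center_iff_val_mem_range_scalar.2 ?_) m)
    rw [Units.val_pow_eq_pow_val]
    exact pow_char_mem_range_scalar h2 hdisc

theorem eq_one_or_eq_neg_one_of_mem_center {x : GL (Fin 2) F}
    (hx : x ∈ Subgroup.center (GL (Fin 2) F)) (hdet : det x = 1) : x = 1 ∨ x = -1 := by
  obtain ⟨a, ha⟩ := mem_center_iff_val_mem_range_scalar.1 hx
  have hd : (x : Matrix (Fin 2) (Fin 2) F).det = 1 := congrArg Units.val hdet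
  rw [← ha] at hd
  have ha1 : a = 1 ∨ a = -1 := by
    simpa [det_fin_two] using hd
  rcases ha1 with rfl | rfl
  · left
    ext1
    simp [← ha]
  · right
    ext1
    rw [← ha, map_neg, map_one, Units.val_neg, Units.val_one]

theorem val_inv_eq_adjugate {x : GL (Fin 2) F} (hdet : det x = 1) :
    (↑x⁻¹ : Matrix (Fin 2) (Fin 2) F) = (x : Matrix (Fin 2) (Fin 2) F).adjugate := by
  have hd : (x : Matrix (Fin 2) (Fin 2) F).det = 1 := congrArg Units.val hdet
  rw [coe_units_inv, inv_def, hd]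
  simp

/-- A subgroup of `GL₂` acting irreducibly over an algebraically closed field is not contained in
the centralizer of a non-scalar element. -/
theorem exists_not_commute_of_irreducible [IsAlgClosed F] {H : Subgroup (GL (Fin 2) F)}
    (hirr : ∀ W : Submodule F (Fin 2 → F),
      (∀ g ∈ H, W.map (Matrix.mulVecLin (g : Matrix (Fin 2) (Fin 2) F)) ≤ W) → W = ⊥ ∨ W = ⊤)
    {x : GL (Fin 2) F} (hx : x ∉ Subgroup.center (GL (Fin 2) F)) :
    ∃ w ∈ H, ¬ Commute x w := by
  by_contra! hcomm
  obtain ⟨μ, hμ⟩ := Module.End.exists_eigenvalue (Matrix.mulVecLin (x : Matrix (Fin 2) (Fin 2) F))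
  obtain ⟨v, hv⟩ := hμ.exists_hasEigenvector
  set W := Module.End.eigenspace (Matrix.mulVecLin (x : Matrix (Fin 2) (Fin 2) F)) μ with hW
  have hinv : ∀ g ∈ H, W.map (Matrix.mulVecLin (g : Matrix (Fin 2) (Fin 2) F)) ≤ W := by
    rintro g hg _ ⟨u, hu, rfl⟩
    have hxg := congrArg Units.val (hcomm g hg).eq
    simp only [Units.val_mul] at hxg
    rw [SetLike.mem_coe, hW, Module.End.mem_eigenspace_iff, mulVecLin_apply] at hu
    rw [hW, Module.End.mem_eigenspace_iff, mulVecLin_apply, mulVecLin_apply, mulVec_mulVec, hxg,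
      ← mulVec_mulVec, hu, mulVec_smul]
  rcases hirr W hinv with h | h
  · exact hv.2 ((Submodule.mem_bot F).1 (h ▸ hv.1))
  · refine hx (mem_center_iff_val_mem_range_scalar.2 ⟨μ, ?_⟩)
    apply Matrix.mulVec_injective
    funext u
    have hu : u ∈ W := h ▸ Submodule.mem_top
    rw [hW, Module.End.mem_eigenspace_iff, mulVecLin_apply] at hu
    rw [hu]
    ext i
    simp [mulVec_diagonal]

/-- Without `-1`, the elements of determinant one in a finite subgroup of `GL₂` of order prime to
the characteristic form a commutative group. -/
theorem commute_of_det_eq_one {p : ℕ} [Fact p.Prime] [CharP F p] (h2 : (2 : F) ≠ 0)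
    {H : Subgroup (GL (Fin 2) F)} [Finite H] (hp : ¬ p ∣ Nat.card H) (hneg : -1 ∉ H)
    {x y : GL (Fin 2) F} (hx : x ∈ H) (hxd : det x = 1) (hy : y ∈ H) (hyd : det y = 1) :
    Commute x y := by
  let K : Subgroup (GL (Fin 2) F) := H ⊓ det.ker
  have hcentral : ∀ z ∈ K, z ∈ Subgroup.center (GL (Fin 2) F) → z = 1 := fun z hz hzc =>
    (eq_one_or_eq_neg_one_of_mem_center hzc hz.2).resolve_right
      fun h => hneg (h ▸ hz.1)
  have hfin : Finite K := Finite.of_injective _ (Subgroup.inclusion_injective inf_le_left)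
  have hsq : ∀ z ∈ K, z ^ 2 = 1 → z = 1 := fun z hz hz2 => by
    refine hcentral z hz (mem_center_iff_val_mem_range_scalar.2
      (mem_range_scalar_of_eq_adjugate h2 ?_))
    rw [← val_inv_eq_adjugate hz.2, ← eq_inv_of_mul_eq_one_left (pow_two z ▸ hz2)]
  have hodd : (2 : ℕ).Coprime (Nat.card K) := by
    refine (Nat.Prime.coprime_iff_not_dvd Nat.prime_two).2 fun h => ?_
    obtain ⟨z, hz⟩ := exists_prime_orderOf_dvd_card' 2 h
    have hz2 : (z : GL (Fin 2) F) ^ 2 = 1 := by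
      exact congrArg Subtype.val (orderOf_dvd_iff_pow_eq_one.1 hz.dvd)
    have hz1 : z = 1 := Subtype.ext (hsq z z.2 hz2)
    rw [hz1, orderOf_one] at hz
    exact absurd hz (by norm_num)
  have hcop : ∀ z ∈ H, p.Coprime (orderOf z) := fun z hz => by
    refine (Nat.Prime.coprime_iff_not_dvd Fact.out).2 fun h => hp (h.trans ?_)
    exact Subgroup.orderOf_dvd_natCard H hz
  refine congrArg Subtype.val (commute_of_commute_conj_of_commute_trans _ rfl (G := K)
    (fun a b c ha hab hac => ?_) (fun a b hab => ?_) ⟨x, hx, hxd⟩ ⟨y, hy, hyd⟩)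
  · exact Subtype.ext (commute_of_commute_of_notMem_center
      (fun h => ha (Subtype.ext (hcentral a a.2 h)))
      (congrArg Subtype.val hab) (congrArg Subtype.val hac))
  · by_cases ha : (a : GL (Fin 2) F) ∈ Subgroup.center (GL (Fin 2) F)
    · exact Subtype.ext (Subgroup.mem_center_iff.1 ha b).symm
    have hconj : b * a * b⁻¹ = a ∨ b * a * b⁻¹ = a⁻¹ := by
      refine (conj_eq_or_eq_adjugate h2 ha (hcop a a.2.1)
        (congrArg Subtype.val hab)).imp (fun h => Subtype.ext h) fun h => ?_
      rw [← val_inv_eq_adjugate a.2.2] at h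
      exact Subtype.ext (Units.ext h)
    rcases hconj with h | h
    · exact (mul_inv_eq_iff_eq_mul.1 h).symm
    · have hsemi : SemiconjBy b a a⁻¹ := mul_inv_eq_iff_eq_mul.1 h
      have hsemi2 : SemiconjBy b a⁻¹ a := by simpa using hsemi.inv_right
      have hb2 : Commute (b ^ 2) a := by
        rw [pow_two]
        exact hsemi2.mul_left hsemi
      obtain ⟨m, hm⟩ := exists_pow_eq_self_of_coprime
        (hodd.coprime_dvd_right (orderOf_dvd_natCard b))
      rw [← hm]
      exact (hb2.pow_left m).symm

/-- A finite irreducible subgroup of `GL₂`, of order prime to the odd characteristic `p` and whose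
image in `PGL₂` contains an element of even order greater than `5`, contains `-1`. -/
theorem neg_one_mem_of_even_orderOf [IsAlgClosed F] {p : ℕ} [Fact p.Prime] [CharP F p]
    (hodd : Odd p) {H : Subgroup (GL (Fin 2) F)} [Finite H] (hp : ¬ p ∣ Nat.card H)
    (hirr : ∀ W : Submodule F (Fin 2 → F),
      (∀ g ∈ H, W.map (Matrix.mulVecLin (g : Matrix (Fin 2) (Fin 2) F)) ≤ W) → W = ⊥ ∨ W = ⊤)
    (hcyc : ∃ g ∈ H,
      Even (orderOf (QuotientGroup.mk' (Subgroup.center (GL (Fin 2) F)) g)) ∧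
      5 < orderOf (QuotientGroup.mk' (Subgroup.center (GL (Fin 2) F)) g)) :
    -1 ∈ H := by
  by_contra hneg
  obtain ⟨g, hg, heven, hlt⟩ := hcyc
  have h2 : (2 : F) ≠ 0 := by
    intro h
    have hdvd : p ∣ 2 := (CharP.cast_eq_zero_iff F p 2).1 (by exact_mod_cast h)
    have h22 := (Nat.prime_dvd_prime_iff_eq Fact.out Nat.prime_two).1 hdvd
    rw [h22] at hodd
    exact absurd hodd (by decide)
  have hcop : ∀ z ∈ H, p.Coprime (orderOf z) := fun z hz => by
    refine (Nat.Prime.coprime_iff_not_dvd Fact.out).2 fun h => hp (h.trans ?_)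
    exact Subgroup.orderOf_dvd_natCard H hz
  have hpow : ∀ n : ℕ, n ≠ 0 →
      n < orderOf (QuotientGroup.mk' (Subgroup.center (GL (Fin 2) F)) g) →
      g ^ n ∉ Subgroup.center (GL (Fin 2) F) := fun n hn hlt hmem => by
    refine pow_ne_one_of_lt_orderOf hn hlt ?_
    rw [← map_pow]
    exact (QuotientGroup.eq_one_iff _).2 hmem
  have hgc : g ∉ Subgroup.center (GL (Fin 2) F) := by
    simpa using hpow 1 one_ne_zero (by omega)
  have hdet_comm : ∀ a b : GL (Fin 2) F, det (a * b * a⁻¹ * b⁻¹) = 1 := by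
    intro a b
    simp only [map_mul, map_inv]
    rw [mul_comm (det a), mul_inv_cancel_right, mul_inv_cancel]
  have hKcenter : ∀ z ∈ H, det z = 1 →
      z ∈ Subgroup.center (GL (Fin 2) F) → z = 1 := fun z hz hzd hzc =>
    (eq_one_or_eq_neg_one_of_mem_center hzc hzd).resolve_right
      fun h => hneg (h ▸ hz)
  obtain ⟨v, hv, hgv⟩ := exists_not_commute_of_irreducible hirr hgc
  set x := g * v * g⁻¹ * v⁻¹ with hxdef
  have hxH : x ∈ H := H.mul_mem (H.mul_mem (H.mul_mem hg hv) (H.inv_mem hg)) (H.inv_mem hv)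
  have hxd : det x = 1 := hdet_comm g v
  have hxc : x ∉ Subgroup.center (GL (Fin 2) F) := fun h => by
    have h1 := hKcenter x hxH hxd h
    rw [hxdef, mul_inv_eq_one, mul_inv_eq_iff_eq_mul] at h1
    exact hgv h1
  have hconj : ∀ y ∈ H, Commute x (y * x * y⁻¹) := fun y hy =>
    commute_of_det_eq_one h2 hp hneg hxH hxd
      (H.mul_mem (H.mul_mem hy hxH) (H.inv_mem hy)) (by simp [hxd])
  have hdich : ∀ y ∈ H, y * x * y⁻¹ = x ∨ y * x * y⁻¹ = x⁻¹ := fun y hy =>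
    (conj_eq_or_eq_adjugate h2 hxc (hcop x hxH) (hconj y hy)).imp_right
      fun h => Units.ext (by rw [h, val_inv_eq_adjugate hxd])
  have hgx : Commute g x := by
    have hg2 : Commute (g ^ 2) x := by
      rcases hdich g hg with h | h
      · exact Commute.pow_left (mul_inv_eq_iff_eq_mul.1 h) 2
      · have hsemi : SemiconjBy g x x⁻¹ := mul_inv_eq_iff_eq_mul.1 h
        have hsemi2 : SemiconjBy g x⁻¹ x := by simpa using hsemi.inv_right
        rw [pow_two]
        exact hsemi2.mul_left hsemi
    exact commute_of_commute_of_notMem_center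
      (hpow 2 two_ne_zero (by omega)) (Commute.pow_self g 2) hg2
  obtain ⟨w, hw, hxw⟩ := exists_not_commute_of_irreducible hirr hxc
  have hwx : w * x * w⁻¹ = x⁻¹ :=
    (hdich w hw).resolve_left fun h => hxw (mul_inv_eq_iff_eq_mul.1 h).symm
  set u := w * g * w⁻¹ with hu
  have hxu : Commute x u := by
    have h : Commute (w * x * w⁻¹) (w * g * w⁻¹) := (Commute.conj_iff w).2 hgx.symm
    rw [hwx] at h
    exact Commute.inv_left_iff.1 h
  have hgu : Commute g u :=
    commute_of_commute_of_notMem_center hxc hgx.symm hxu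
  have huadj : (u : Matrix (Fin 2) (Fin 2) F) = (g : Matrix (Fin 2) (Fin 2) F).adjugate := by
    refine (conj_eq_or_eq_adjugate h2 hgc (hcop g hg) hgu).resolve_left
      fun h => hxw ?_
    exact commute_of_commute_of_notMem_center hgc hgx
      (mul_inv_eq_iff_eq_mul.1 h).symm
  obtain ⟨m, hm⟩ := heven
  have hgm := hpow m (by omega) (by omega)
  have hg2m : g ^ (m + m) ∈ Subgroup.center (GL (Fin 2) F) := by
    rw [← QuotientGroup.eq_one_iff, ← hm]
    exact pow_orderOf_eq_one (QuotientGroup.mk' (Subgroup.center (GL (Fin 2) F)) g)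
  have hgum : g ^ m * u ^ m ∈ Subgroup.center (GL (Fin 2) F) := by
    rw [← hgu.mul_pow]
    refine Subgroup.pow_mem _ (mem_center_iff_val_mem_range_scalar.2
      ⟨(g : Matrix (Fin 2) (Fin 2) F).det, ?_⟩) m
    rw [Units.val_mul, huadj, mul_adjugate, smul_one_eq_diagonal, scalar_apply]
  have huH : u ∈ H := H.mul_mem (H.mul_mem hw hg) (H.inv_mem hw)
  have hugm : u ^ m * (g ^ m)⁻¹ = 1 := by
    refine hKcenter _ (H.mul_mem (H.pow_mem huH m) (H.inv_mem (H.pow_mem hg m))) ?_ ?_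
    · simp [hu]
    · have h : u ^ m * (g ^ m)⁻¹ = (g ^ (m + m))⁻¹ * (g ^ m * u ^ m) := by
        rw [pow_add, _root_.mul_inv_rev, mul_assoc, inv_mul_cancel_left]
        exact ((hgu.pow_pow m m).inv_left).symm.eq
      rw [h]
      exact Subgroup.mul_mem _ (Subgroup.inv_mem _ hg2m) hgum
  refine hgm (mem_center_iff_val_mem_range_scalar.2
    (mem_range_scalar_of_eq_adjugate h2 ?_))
  rw [Units.val_pow_eq_pow_val, adjugate_pow, ← huadj, ← Units.val_pow_eq_pow_val,
    ← Units.val_pow_eq_pow_val, mul_inv_eq_one.1 hugm]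

end GeneralLinearGroup

end Matrix

theorem statement2 (p : ℕ) [Fact p.Prime] (hodd : Odd p)
    (H : Subgroup (GL (Fin 2) (AlgebraicClosure (ZMod p)))) [Finite H]
    (hp : ¬ p ∣ Nat.card H)
    -- `H` acts irreducibly on `\bar F_p²`
    (hirr : ∀ W : Submodule (AlgebraicClosure (ZMod p)) (Fin 2 → AlgebraicClosure (ZMod p)),
      (∀ g ∈ H, W.map (Matrix.mulVecLin
        (g : Matrix (Fin 2) (Fin 2) (AlgebraicClosure (ZMod p)))) ≤ W) → W = ⊥ ∨ W = ⊤)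
    -- the image of `H` in `PGL₂(\bar F_p)` contains a cyclic subgroup of even order `> 5`
    (hcyc : ∃ g ∈ H,
      Even (orderOf (QuotientGroup.mk' (Subgroup.center
        (GL (Fin 2) (AlgebraicClosure (ZMod p)))) g)) ∧
      5 < orderOf (QuotientGroup.mk' (Subgroup.center
        (GL (Fin 2) (AlgebraicClosure (ZMod p)))) g)) :
    (-1 : GL (Fin 2) (AlgebraicClosure (ZMod p))) ∈ H := by
  exact GeneralLinearGroup.neg_one_mem_of_even_orderOf hodd hp hirr hcyc
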